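/- Let α∈(0,2), H∈(0,1) and κ=H−1/α, and suppose κ<0. Let q>0, b₁∈{−1,1}, and let F₁,F₂:[0,q]→ℝ be bounded and Lipschitz continuous. Define K:ℝ→ℝ by K(u) = b₁^{[ln|u|]_q}( F₁({ln|u|}_q)·u₊^κ + F₂({ln|u|}_q)·u₋^κ ) for u≠0 and K(0)=0. Then ∫₁^{e^q} h^{−αH−1} ( ∫_ℝ |K(u+h)−K(u)|^α du ) dh < ∞. -/

import Mathlib

open MeasureTheory

/-- `{x}_a = x - a⌊x/a⌋`, the fractional part with period `a`. -/
noncomputable def fpart (a x : ℝ) : ℝ := x - a * ⌊x / a⌋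

/-- `u₊^κ`: equals `u^κ` for `u > 0` and `0` for `u ≤ 0`; for `κ = 0` it is the
indicator of `(0,∞)` (via `rpow`). -/
noncomputable def pPow (κ u : ℝ) : ℝ := if 0 < u then u ^ κ else 0

/-- `u₋^κ`: equals `|u|^κ` for `u < 0` and `0` for `u > 0`; for `κ = 0` it is the
indicator of `(-∞,0]` (via `rpow`, since `0 ^ 0 = 1`). -/
noncomputable def mPow (κ u : ℝ) : ℝ := if u ≤ 0 then |u| ^ κ else 0

lemma fpart_mem_Icc {q : ℝ} (hq : 0 < q) (x : ℝ) : fpart q x ∈ Set.Icc (0:ℝ) q := by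
  have h1 := Int.floor_le (x / q)
  have h2 := Int.lt_floor_add_one (x / q)
  rw [le_div_iff₀ hq] at h1
  rw [div_lt_iff₀ hq] at h2
  constructor <;> unfold fpart <;> nlinarith

lemma one_add_mul_le_rpow_one_add_of_nonpos {κ x : ℝ} (hκ : κ ≤ 0) (hx : 0 ≤ x) :
    1 + κ * x ≤ (1 + x) ^ κ := by
  rw [Real.rpow_def_of_pos (by linarith)]
  have h1 := Real.add_one_le_exp (Real.log (1 + x) * κ)
  have h2 := Real.log_le_sub_one_of_pos (show 0 < 1 + x by linarith)
  nlinarith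

/-- The oscillation of a log-periodic power function between two points with the same
number of completed periods. -/
lemma abs_sub_le_of_floor_eq {κ q b C M h u : ℝ} {L : NNReal} {F g : ℝ → ℝ} (hκ : κ ≤ 0)
    (hq : 0 < q) (hb : |b| = 1) (hbdd : ∀ x ∈ Set.Icc (0:ℝ) q, |F x| ≤ C)
    (hlip : LipschitzOnWith L F (Set.Icc (0:ℝ) q))
    (hg : ∀ u : ℝ, 0 < u → g u = b ^ ⌊Real.log u / q⌋ * (F (fpart q (Real.log u)) * u ^ κ))
    (hu : 0 < u) (hh : 0 ≤ h) (hhM : h ≤ M)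
    (hfl : ⌊Real.log (u + h) / q⌋ = ⌊Real.log u / q⌋) :
    |g (u + h) - g u| ≤ (L + C * -κ) * M * u ^ (κ - 1) := by
  have huh : 0 < u + h := by linarith
  have hbn : |b ^ ⌊Real.log u / q⌋| = 1 := by rw [abs_zpow, hb, one_zpow]
  have hC : 0 ≤ C := (abs_nonneg _).trans (hbdd 0 ⟨le_rfl, hq.le⟩)
  rw [hg _ hu, hg _ huh, hfl, ← mul_sub, abs_mul, hbn, one_mul]
  have hfac : u + h = u * (1 + h / u) := by field_simp
  have hx : 0 ≤ h / u := by positivity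
  have hlog : Real.log (u + h) - Real.log u ≤ h / u := by
    rw [hfac, Real.log_mul hu.ne' (by positivity)]
    have := Real.log_le_sub_one_of_pos (show 0 < 1 + h / u by positivity)
    linarith
  have hlog0 : 0 ≤ Real.log (u + h) - Real.log u :=
    sub_nonneg.2 (Real.log_le_log hu (by linarith))
  have hF : |F (fpart q (Real.log (u + h))) - F (fpart q (Real.log u))| ≤ L * (h / u) := by
    have := hlip.dist_le_mul _ (fpart_mem_Icc hq (Real.log (u + h))) _
      (fpart_mem_Icc hq (Real.log u))
    rw [Real.dist_eq, Real.dist_eq] at this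
    refine this.trans (mul_le_mul_of_nonneg_left ?_ L.2)
    unfold fpart
    rw [hfl, abs_le]
    constructor <;> linarith
  have hpow : |(u + h) ^ κ - u ^ κ| ≤ -κ * (h / u) * u ^ κ := by
    have h1 : (u + h) ^ κ ≤ u ^ κ := Real.rpow_le_rpow_of_nonpos hu (by linarith) hκ
    have h2 : u ^ κ * (1 + κ * (h / u)) ≤ (u + h) ^ κ := by
      rw [hfac, Real.mul_rpow hu.le (by positivity)]
      exact mul_le_mul_of_nonneg_left (one_add_mul_le_rpow_one_add_of_nonpos hκ hx)
        (by positivity)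
    rw [abs_of_nonpos (by linarith)]
    linarith
  have hu1 : u ^ (κ - 1) = u ^ κ / u := Real.rpow_sub_one hu.ne' κ
  have hup : 0 < u ^ κ := by positivity
  calc |F (fpart q (Real.log (u + h))) * (u + h) ^ κ - F (fpart q (Real.log u)) * u ^ κ|
      = |(F (fpart q (Real.log (u + h))) - F (fpart q (Real.log u))) * u ^ κ
          + F (fpart q (Real.log (u + h))) * ((u + h) ^ κ - u ^ κ)| := by congr 1; ring
    _ ≤ L * (h / u) * u ^ κ + C * (-κ * (h / u) * u ^ κ) := by
        refine (abs_add_le _ _).trans ?_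
        rw [abs_mul, abs_mul, abs_of_pos hup]
        gcongr
        exact hbdd _ (fpart_mem_Icc hq _)
    _ = (L + C * -κ) * h * u ^ (κ - 1) := by rw [hu1]; ring
    _ ≤ (L + C * -κ) * M * u ^ (κ - 1) := by
        have : 0 ≤ C * -κ := mul_nonneg hC (by linarith)
        gcongr

/-- A bound on the values of a log-periodic power function. -/
lemma abs_le_mul_rpow {κ q b C u : ℝ} {F g : ℝ → ℝ}
    (hq : 0 < q) (hb : |b| = 1) (hbdd : ∀ x ∈ Set.Icc (0:ℝ) q, |F x| ≤ C)
    (hg : ∀ u : ℝ, 0 < u → g u = b ^ ⌊Real.log u / q⌋ * (F (fpart q (Real.log u)) * u ^ κ))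
    (hu : 0 < u) : |g u| ≤ C * u ^ κ := by
  have hup : 0 < u ^ κ := by positivity
  rw [hg _ hu, abs_mul, abs_zpow, hb, one_zpow, one_mul, abs_mul, abs_of_pos hup]
  exact mul_le_mul_of_nonneg_right (hbdd _ (fpart_mem_Icc hq _)) hup.le

/-- If a multiple of `q` separates `log u` from `log (u + h)`, it is controlled by `u`. -/
lemma exists_exp_mem_of_floor_ne {q M h u : ℝ} (hq : 0 < q) (hu : 1 < u) (hh : 0 ≤ h)
    (hhM : h ≤ M) (hfl : ⌊Real.log (u + h) / q⌋ ≠ ⌊Real.log u / q⌋) :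
    ∃ n : ℕ, u ∈ Set.Ico (Real.exp (n * q) - M) (Real.exp (n * q)) := by
  have hu0 : 0 < u := by linarith
  have hlog0 : Real.log u ≤ Real.log (u + h) := Real.log_le_log hu0 (by linarith)
  have hle : ⌊Real.log u / q⌋ ≤ ⌊Real.log (u + h) / q⌋ := Int.floor_le_floor (by gcongr)
  have hlt := lt_of_le_of_ne hle hfl.symm
  have h0 : 0 ≤ ⌊Real.log u / q⌋ := Int.floor_nonneg.2 (div_nonneg (Real.log_nonneg hu.le) hq.le)
  obtain ⟨n, hn⟩ := Int.eq_ofNat_of_zero_le (h0.trans hle)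
  refine ⟨n, ?_, ?_⟩
  · have h1 := Int.floor_le (Real.log (u + h) / q)
    rw [hn, le_div_iff₀ hq, Real.le_log_iff_exp_le (by linarith)] at h1
    push_cast at h1
    linarith
  · have h2 := Int.lt_floor_add_one (Real.log u / q)
    have h3 : (⌊Real.log u / q⌋ : ℝ) + 1 ≤ n := by
      have : ⌊Real.log u / q⌋ + 1 ≤ (n : ℤ) := by rw [hn] at hlt; exact hlt
      exact_mod_cast this
    rw [← Real.log_lt_iff_lt_exp hu0, ← div_lt_iff₀ hq]
    linarith

/-- The increments of a log-periodic power function have an integrable majorant, uniformly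
over bounded increments. -/
lemma exists_majorant_increment {α κ q b C M : ℝ} {L : NNReal} {F g : ℝ → ℝ} (hα : 0 < α)
    (hκ : κ < 0) (hκα : (κ - 1) * α < -1)
    (hq : 0 < q) (hb : |b| = 1) (hbdd : ∀ x ∈ Set.Icc (0:ℝ) q, |F x| ≤ C)
    (hlip : LipschitzOnWith L F (Set.Icc (0:ℝ) q)) (hM : 0 ≤ M)
    (hg : ∀ u : ℝ, 0 < u → g u = b ^ ⌊Real.log u / q⌋ * (F (fpart q (Real.log u)) * u ^ κ)) :
    ∃ T : ℝ → ENNReal, Measurable T ∧ ∫⁻ u, T u < ⊤ ∧ ∀ h u : ℝ, 0 ≤ h → h ≤ M → 1 < u →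
      ENNReal.ofReal (|g (u + h) - g u| ^ α) ≤ T u := by
  have hC : 0 ≤ C := (abs_nonneg _).trans (hbdd 0 ⟨le_rfl, hq.le⟩)
  set D : ℝ := (L + C * -κ) * M
  have hD : 0 ≤ D := mul_nonneg (add_nonneg L.2 (mul_nonneg hC (by linarith))) hM
  set E : ℝ := (2 * C * (1 + M) ^ (-κ)) ^ α
  have hE : 0 ≤ E := by positivity
  set r : ℝ := Real.exp (q * κ * α)
  have hr1 : r < 1 := Real.exp_lt_one_iff.2 (mul_neg_of_neg_of_pos (mul_neg_of_pos_of_neg hq hκ) hα)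
  let S : ℝ → ENNReal := (Set.Ioi (1:ℝ)).indicator
    fun u ↦ ENNReal.ofReal (D ^ α * u ^ ((κ - 1) * α))
  let J : ℕ → ℝ → ENNReal := fun n ↦
    (Set.Ico (Real.exp (n * q) - M) (Real.exp (n * q))).indicator
      fun _ ↦ ENNReal.ofReal (E * r ^ n)
  have hS : Measurable S := Measurable.indicator (by fun_prop) measurableSet_Ioi
  have hJ : ∀ n, Measurable (J n) := fun n ↦ measurable_const.indicator measurableSet_Ico
  refine ⟨fun u ↦ S u + ∑' n, J n u, hS.add (Measurable.tsum hJ), ?_, ?_⟩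
  · rw [lintegral_add_left hS, lintegral_tsum fun n ↦ (hJ n).aemeasurable]
    refine ENNReal.add_lt_top.2 ⟨?_, ?_⟩
    · rw [lintegral_indicator measurableSet_Ioi]
      exact ((integrableOn_Ioi_rpow_of_lt hκα one_pos).const_mul _).lintegral_lt_top
    · have : ∀ n, ∫⁻ u, J n u = ENNReal.ofReal (E * r ^ n * M) := fun n ↦ by
        rw [lintegral_indicator measurableSet_Ico, setLIntegral_const, Real.volume_Ico,
          sub_sub_cancel, ENNReal.ofReal_mul (p := E * r ^ n) (by positivity)]
      simp_rw [this]
      exact (((summable_geometric_of_lt_one (Real.exp_pos _).le hr1).mul_left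
        E).mul_right M).tsum_ofReal_lt_top
  · intro h u hh hhM hu
    have hu0 : 0 < u := by linarith
    by_cases hfl : ⌊Real.log (u + h) / q⌋ = ⌊Real.log u / q⌋
    · refine le_trans ?_ le_self_add
      simp only [S, Set.indicator_of_mem (Set.mem_Ioi.2 hu)]
      refine ENNReal.ofReal_le_ofReal ?_
      rw [Real.rpow_mul hu0.le, ← Real.mul_rpow hD (by positivity)]
      exact Real.rpow_le_rpow (abs_nonneg _)
        (abs_sub_le_of_floor_eq hκ.le hq hb hbdd hlip hg hu0 hh hhM hfl) hα.le
    · obtain ⟨n, hn⟩ := exists_exp_mem_of_floor_ne hq hu hh hhM hfl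
      refine le_trans ?_ le_add_self
      refine le_trans ?_ (ENNReal.le_tsum n)
      simp only [J, Set.indicator_of_mem hn]
      refine ENNReal.ofReal_le_ofReal ?_
      have hr : E * r ^ n = (2 * C * ((1 + M) ^ (-κ) * Real.exp (n * q) ^ κ)) ^ α := by
        rw [← mul_assoc, Real.mul_rpow (by positivity) (by positivity), ← Real.exp_mul,
          ← Real.exp_mul, ← Real.exp_nat_mul]
        congr 2
        ring
      rw [hr]
      refine Real.rpow_le_rpow (abs_nonneg _) ?_ hα.le
      have h1 : u ^ κ ≤ (1 + M) ^ (-κ) * Real.exp (n * q) ^ κ := by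
        rw [Real.rpow_neg (by positivity), inv_mul_eq_div,
          ← Real.div_rpow (by positivity) (by positivity)]
        refine Real.rpow_le_rpow_of_nonpos (by positivity) ?_ hκ.le
        rw [div_le_iff₀ (by positivity)]
        nlinarith [hn.1]
      have h2 : (u + h) ^ κ ≤ u ^ κ := Real.rpow_le_rpow_of_nonpos hu0 (by linarith) hκ.le
      have h3 := abs_le_mul_rpow hq hb hbdd hg hu0
      have h4 := abs_le_mul_rpow hq hb hbdd hg (show 0 < u + h by linarith)
      have h5 := abs_sub (g (u + h)) (g u)
      have h6 := mul_le_mul_of_nonneg_left h1 hC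
      have h7 := mul_le_mul_of_nonneg_left h2 hC
      linarith

/-- A locally integrable power singularity at the origin, cut off outside `[-N, N]`. -/
lemma exists_majorant_rpow_abs {r : ℝ} (hr : -1 < r) (hr0 : r ≠ 0) (N : ℝ) :
    ∃ P : ℝ → ENNReal, Measurable P ∧ ∫⁻ u, P u < ⊤ ∧ ∀ u : ℝ, |u| ≤ N →
      ENNReal.ofReal (|u| ^ r) ≤ P u := by
  let p : ℝ → ENNReal := (Set.Ioc 0 N).indicator fun u ↦ ENNReal.ofReal (u ^ r)
  have hp : Measurable p := Measurable.indicator (by fun_prop) measurableSet_Ioc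
  have hpi : ∫⁻ u, p u < ⊤ := by
    rw [lintegral_indicator measurableSet_Ioc]
    rcases le_total 0 N with hN | hN
    · have := intervalIntegral.intervalIntegrable_rpow' (a := 0) (b := N) hr
      exact ((intervalIntegrable_iff_integrableOn_Ioc_of_le hN).1 this).lintegral_lt_top
    · simp [Set.Ioc_eq_empty_of_le hN]
  refine ⟨fun u ↦ p u + p (-u), hp.add (hp.comp measurable_neg), ?_, ?_⟩
  · rw [lintegral_add_left hp, lintegral_neg_eq_self (μ := volume) p]
    exact ENNReal.add_lt_top.2 ⟨hpi, hpi⟩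
  · intro u hu
    rcases lt_trichotomy u 0 with h | h | h
    · rw [abs_of_neg h] at hu ⊢
      refine le_trans ?_ le_add_self
      simp only [p, Set.indicator_of_mem (show -u ∈ Set.Ioc 0 N from ⟨by linarith, hu⟩), le_refl]
    · simp [h, Real.zero_rpow hr0]
    · rw [abs_of_pos h] at hu ⊢
      refine le_trans ?_ le_self_add
      simp only [p, Set.indicator_of_mem (show u ∈ Set.Ioc 0 N from ⟨h, hu⟩), le_refl]

lemma abs_sub_rpow_le {α : ℝ} (hα : 0 < α) (a b : ℝ) :
    |a - b| ^ α ≤ 2 ^ α * (|a| ^ α + |b| ^ α) := by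
  have h1 : |a - b| ≤ 2 * max |a| |b| := by
    have := abs_sub a b
    linarith [le_max_left |a| |b|, le_max_right |a| |b|]
  have ha : 0 ≤ |a| ^ α := by positivity
  have hb : 0 ≤ |b| ^ α := by positivity
  calc |a - b| ^ α ≤ (2 * max |a| |b|) ^ α := Real.rpow_le_rpow (abs_nonneg _) h1 hα.le
    _ = 2 ^ α * (max |a| |b|) ^ α := Real.mul_rpow (by norm_num) (by positivity)
    _ ≤ 2 ^ α * (|a| ^ α + |b| ^ α) := by
        gcongr
        rcases max_choice |a| |b| with h | h <;> rw [h] <;> linarith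

theorem stmt0 (α H κ q b₁ : ℝ) (hα0 : 0 < α) (hα2 : α < 2)
    (hH0 : 0 < H) (hH1 : H < 1) (hκ : κ = H - 1 / α) (hκ0 : κ < 0)
    (hq : 0 < q) (hb : b₁ = 1 ∨ b₁ = -1)
    (F₁ F₂ : ℝ → ℝ) (C : ℝ) (L₁ L₂ : NNReal)
    (hF₁bdd : ∀ x ∈ Set.Icc (0:ℝ) q, |F₁ x| ≤ C)
    (hF₂bdd : ∀ x ∈ Set.Icc (0:ℝ) q, |F₂ x| ≤ C)
    (hF₁lip : LipschitzOnWith L₁ F₁ (Set.Icc (0:ℝ) q))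
    (hF₂lip : LipschitzOnWith L₂ F₂ (Set.Icc (0:ℝ) q))
    (K : ℝ → ℝ)
    (hK : ∀ u : ℝ, u ≠ 0 → K u =
      b₁ ^ ⌊Real.log |u| / q⌋ *
        (F₁ (fpart q (Real.log |u|)) * pPow κ u + F₂ (fpart q (Real.log |u|)) * mPow κ u))
    (hK0 : K 0 = 0) :
    ∫⁻ h in Set.Ioo (1:ℝ) (Real.exp q),
      ENNReal.ofReal (h ^ (-(α * H) - 1)) *
        ∫⁻ u : ℝ, ENNReal.ofReal (|K (u + h) - K u| ^ α) < ⊤ := by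
  have hb' : |b₁| = 1 := by rcases hb with rfl | rfl <;> simp
  have hκα : κ * α = α * H - 1 := by rw [hκ]; field_simp
  have hαH : 0 < α * H := mul_pos hα0 hH0
  have hκα1 : (κ - 1) * α < -1 := by nlinarith
  have hC : 0 ≤ C := (abs_nonneg _).trans (hF₁bdd 0 ⟨le_rfl, hq.le⟩)
  set M := Real.exp q
  have hM : 0 ≤ M := (Real.exp_pos q).le
  have hKpos : ∀ u : ℝ, 0 < u →
      K u = b₁ ^ ⌊Real.log u / q⌋ * (F₁ (fpart q (Real.log u)) * u ^ κ) := fun u hu ↦ by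
    simp [hK u hu.ne', pPow, mPow, hu, hu.not_ge, abs_of_pos hu]
  have hKneg : ∀ u : ℝ, 0 < u →
      K (-u) = b₁ ^ ⌊Real.log u / q⌋ * (F₂ (fpart q (Real.log u)) * u ^ κ) := fun u hu ↦ by
    simp [hK (-u) (neg_ne_zero.2 hu.ne'), pPow, mPow, hu.le, hu.le.not_gt, abs_of_pos hu]
  have hKle : ∀ u, |K u| ≤ C * |u| ^ κ := fun u ↦ by
    rcases lt_trichotomy u 0 with h | rfl | h
    · have := abs_le_mul_rpow (g := fun u ↦ K (-u)) hq hb' hF₂bdd hKneg (neg_pos.2 h)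
      simpa [abs_of_neg h] using this
    · simp [hK0, Real.zero_rpow hκ0.ne]
    · simpa [abs_of_pos h] using abs_le_mul_rpow hq hb' hF₁bdd hKpos h
  obtain ⟨T₁, hT₁, hT₁i, hT₁le⟩ :=
    exists_majorant_increment hα0 hκ0 hκα1 hq hb' hF₁bdd hF₁lip hM hKpos
  obtain ⟨T₂, hT₂, hT₂i, hT₂le⟩ := exists_majorant_increment (g := fun u ↦ K (-u))
    hα0 hκ0 hκα1 hq hb' hF₂bdd hF₂lip hM hKneg
  obtain ⟨P, hP, hPi, hPle⟩ := exists_majorant_rpow_abs (r := κ * α) (by linarith)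
    (mul_neg_of_neg_of_pos hκ0 hα0).ne (2 * M + 1)
  set A : ENNReal := ENNReal.ofReal (2 ^ α * C ^ α)
  have hpt : ∀ h ∈ Set.Ioo 1 M, ∀ u, ENNReal.ofReal (|K (u + h) - K u| ^ α) ≤
      T₁ u + (T₂ (-(u + h)) + A * (P (u + h) + P u)) := by
    rintro h ⟨hh1, hhM⟩ u
    rcases lt_or_ge 1 u with h1 | h1
    · exact (hT₁le h u (by linarith) hhM.le h1).trans le_self_add
    rcases lt_or_ge 1 (-(u + h)) with h2 | h2
    · refine le_trans ?_ (le_self_add.trans le_add_self)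
      have := hT₂le h (-(u + h)) (by linarith) hhM.le h2
      rw [abs_sub_comm]
      simpa using this
    refine le_trans ?_ (le_add_self.trans le_add_self)
    have hKα : ∀ v, |K v| ^ α ≤ C ^ α * |v| ^ (κ * α) := fun v ↦ by
      rw [Real.rpow_mul (abs_nonneg v), ← Real.mul_rpow hC (by positivity)]
      exact Real.rpow_le_rpow (abs_nonneg _) (hKle v) hα0.le
    calc ENNReal.ofReal (|K (u + h) - K u| ^ α)
        ≤ ENNReal.ofReal (2 ^ α * C ^ α * (|u + h| ^ (κ * α) + |u| ^ (κ * α))) := by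
          refine ENNReal.ofReal_le_ofReal ((abs_sub_rpow_le hα0 _ _).trans ?_)
          rw [mul_assoc, mul_add (C ^ α)]
          gcongr <;> exact hKα _
      _ = A * (ENNReal.ofReal (|u + h| ^ (κ * α)) + ENNReal.ofReal (|u| ^ (κ * α))) := by
          rw [ENNReal.ofReal_mul (by positivity),
            ENNReal.ofReal_add (by positivity) (by positivity)]
      _ ≤ A * (P (u + h) + P u) := by
          gcongr <;> refine hPle _ (abs_le.2 ⟨?_, ?_⟩) <;> linarith
  set B : ENNReal := (∫⁻ u, T₁ u) + ((∫⁻ u, T₂ u) + A * ((∫⁻ u, P u) + ∫⁻ u, P u))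
  have hB : B < ⊤ := by
    refine ENNReal.add_lt_top.2 ⟨hT₁i, ENNReal.add_lt_top.2 ⟨hT₂i, ?_⟩⟩
    exact ENNReal.mul_lt_top ENNReal.ofReal_lt_top (ENNReal.add_lt_top.2 ⟨hPi, hPi⟩)
  have hint : ∀ h ∈ Set.Ioo 1 M, ∫⁻ u, ENNReal.ofReal (|K (u + h) - K u| ^ α) ≤ B := by
    intro h hh
    refine (lintegral_mono (hpt h hh)).trans (le_of_eq ?_)
    rw [lintegral_add_left hT₁, lintegral_add_left (by fun_prop),
      lintegral_const_mul _ (by fun_prop), lintegral_add_right _ hP,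
      lintegral_add_right_eq_self P h, lintegral_add_right_eq_self (fun u ↦ T₂ (-u)) h,
      lintegral_neg_eq_self (μ := volume) T₂]
  calc _ ≤ ∫⁻ _ in Set.Ioo (1:ℝ) M, B := by
        refine setLIntegral_mono measurable_const fun h hh ↦ ?_
        refine (mul_le_mul' ?_ (hint h hh)).trans_eq (one_mul B)
        rw [ENNReal.ofReal_le_one]
        exact Real.rpow_le_one_of_one_le_of_nonpos hh.1.le (by linarith)
    _ < ⊤ := by
        rw [setLIntegral_const, Real.volume_Ioo]
        exact ENNReal.mul_lt_top hB ENNReal.ofReal_lt_top
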